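/- Let X be a compactly generated weak Hausdorff space, F : ℝ≥0 × X ⇀ X a partial semiflow, and K ⊆ X a compact subset such that [0,ε] × K ⊆ Dom F for some ε > 0. Then for any a, b ∈ ℝ≥0 with a ≤ b, the set f^a(⋂_{t∈[0,b]} f^{-t}(K)) is compact and closed in X. -/

import Mathlib

open Set Function
open scoped NNReal

/-- A partial semiflow on a topological space `X`: a continuous partial map
`F : ℝ≥0 × X ⇀ X` (underlying total function `toFun`, domain `dom`) such that
`f^0 = id` and `f^t ∘ f^u = f^{t+u}` as partial maps. -/
structure PSemiflow (X : Type*) [TopologicalSpace X] where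
  toFun : ℝ≥0 × X → X
  dom : Set (ℝ≥0 × X)
  cont : ContinuousOn toFun dom
  mem_zero : ∀ x : X, (0, x) ∈ dom
  map_zero : ∀ x : X, toFun (0, x) = x
  mem_add : ∀ (t u : ℝ≥0) (x : X),
    (t + u, x) ∈ dom ↔ (u, x) ∈ dom ∧ (t, toFun (u, x)) ∈ dom
  map_add : ∀ (t u : ℝ≥0) (x : X), (u, x) ∈ dom → (t, toFun (u, x)) ∈ dom →
    toFun (t, toFun (u, x)) = toFun (t + u, x)

/-- Properness of the partial map obtained by restricting `g` to `S`, viewed as a map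
into the subspace `T`. -/
def PProper {α β : Type*} [TopologicalSpace α] [TopologicalSpace β]
    (g : α → β) (S : Set α) (T : Set β) : Prop :=
  ∀ h : Set.MapsTo g S T, IsProperMap (Set.MapsTo.restrict g S T h)

namespace PSemiflow

variable {X : Type*} [TopologicalSpace X]

/-- `f^{-t}(E)`: the preimage of `E` under the partial map `f^t`. -/
def fpre (F : PSemiflow X) (t : ℝ≥0) (E : Set X) : Set X :=
  {x | (t, x) ∈ F.dom ∧ F.toFun (t, x) ∈ E}

/-- `F` is finite-time proper: for every `t ≥ 0`, the restriction `F|_{[0,t] × X}`,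
viewed as a partial map, is proper. -/
def FiniteTimeProper (F : PSemiflow X) : Prop :=
  ∀ t : ℝ≥0,
    IsProperMap fun p : ↥(F.dom ∩ (Set.Icc 0 t ×ˢ (Set.univ : Set X))) => F.toFun p.1

/-- `F` is openly defined: its domain is open in `ℝ≥0 × X`. -/
def OpenlyDefined (F : PSemiflow X) : Prop := IsOpen F.dom

/-- The domain of the induced partial semiflow `F_E`:
`(t, x)` with `x ∈ ⋂_{s ∈ [0,t]} f^{-s}(E)`. -/
def domInd (F : PSemiflow X) (E : Set X) : Set (ℝ≥0 × X) :=
  {p | ∀ s ∈ Set.Icc 0 p.1, p.2 ∈ F.fpre s E}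

/-- The induced partial semiflow `F_E : ℝ≥0 × E ⇀ E` is finite-time proper. -/
def IndFiniteTimeProper (F : PSemiflow X) (E : Set X) : Prop :=
  ∀ t : ℝ≥0, PProper F.toFun (F.domInd E ∩ (Set.Icc 0 t ×ˢ (Set.univ : Set X))) E

/-- The induced partial semiflow `F_E : ℝ≥0 × E ⇀ E` is openly defined, i.e. its
domain is open in `ℝ≥0 × E`. -/
def IndOpenlyDefined (F : PSemiflow X) (E : Set X) : Prop :=
  IsOpen {p : ℝ≥0 × ↥E | (p.1, (p.2 : X)) ∈ F.domInd E}

/-- `(a,b,c)` is `(E,E')`-admissible relative to `F`. -/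
def adm (F : PSemiflow X) (E E' : Set X) (a b c : ℝ≥0) : Prop :=
  a ≤ b ∧ b ≤ c ∧
    (⋂ t ∈ Set.Icc (0 : ℝ≥0) b, F.fpre t E) ⊆ F.fpre a E' ∧
    (⋂ t ∈ Set.Icc (0 : ℝ≥0) (c - a), F.fpre t E') ⊆ F.fpre (b - a) E

/-- The domain of the partial map `f_{E'E}^{(a,b,c)} : E ⇀ E'`. -/
def dmain (F : PSemiflow X) (E E' : Set X) (a b c : ℝ≥0) : Set X :=
  (⋂ t ∈ Set.Icc (0 : ℝ≥0) b, F.fpre t E) ∩ ⋂ t ∈ Set.Icc a c, F.fpre t E'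

/-- `S` is `F`-invariant. -/
def Invariant (F : PSemiflow X) (S : Set X) : Prop :=
  ∀ t : ℝ≥0, (∀ x ∈ S, (t, x) ∈ F.dom) ∧ (fun x => F.toFun (t, x)) '' S = S

/-- The `F`-invariant part of `E`. -/
def invPart (F : PSemiflow X) (E : Set X) : Set X :=
  ⋂ (a : ℝ≥0) (b : ℝ≥0) (_ : a ≤ b),
    (fun x => F.toFun (a, x)) '' ⋂ t ∈ Set.Icc (0 : ℝ≥0) b, F.fpre t E

/-- `E` is an isolating neighbourhood of `S`. -/
def Isolating (F : PSemiflow X) (S E : Set X) : Prop :=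
  S ⊆ interior E ∧ IsCompact (closure E) ∧
    (∃ ε : ℝ≥0, 0 < ε ∧ Set.Icc 0 ε ×ˢ closure E ⊆ F.dom) ∧
    S = F.invPart (closure E)

/-- The relation `E ∼_F E'`. -/
def Sim (F : PSemiflow X) (E E' : Set X) : Prop :=
  ∃ a b a' b' : ℝ≥0, a ≤ b ∧ a' ≤ b' ∧
    (⋂ t ∈ Set.Icc (0 : ℝ≥0) b, F.fpre t E) ⊆ F.fpre a E' ∧
    (⋂ t ∈ Set.Icc (0 : ℝ≥0) b', F.fpre t E') ⊆ F.fpre a' E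

/-- `E` is weakly `F`-compactifiable. -/
def WCptif (F : PSemiflow X) (E : Set X) : Prop :=
  F.IndFiniteTimeProper E ∧ F.IndOpenlyDefined E

/-- `E` is `F`-compactifiable. -/
def Cptif (F : PSemiflow X) (E : Set X) : Prop :=
  F.WCptif E ∧ LocallyCompactSpace E ∧ T2Space E


universe u

/-- `X` is weak Hausdorff: images of compact Hausdorff spaces under continuous maps
are closed. -/
def WeakHausdorffSpace (X : Type u) [TopologicalSpace X] : Prop :=
  ∀ (K : Type u) [TopologicalSpace K] [CompactSpace K] [T2Space K],
    ∀ g : K → X, Continuous g → IsClosed (Set.range g)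

/-- `X` is compactly generated: every compactly closed subset is closed. -/
def CompactlyGeneratedSpaceP (X : Type u) [TopologicalSpace X] : Prop :=
  ∀ A : Set X,
    (∀ (K : Type u) [TopologicalSpace K] [CompactSpace K] [T2Space K],
      ∀ g : K → X, Continuous g → IsClosed (g ⁻¹' A)) → IsClosed A

theorem isClosed_of_isCompact_cgwh {Y : Type u} [TopologicalSpace Y]
    (hcg : CompactlyGeneratedSpaceP Y) (hwh : WeakHausdorffSpace Y)
    (K : Set Y) (hK : IsCompact K) : IsClosed K := by
  have hpt : ∀ y : Y, IsClosed ({y} : Set Y) := by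
    intro y
    have := hwh PUnit (fun _ => y) continuous_const
    simpa using this
  refine hcg K ?_
  intro L _ _ _ g hg
  have hclosed : ∀ C : Set L, IsClosed C → IsClosed (g '' C) := by
    intro C hC
    haveI : CompactSpace C := isCompact_iff_compactSpace.mp hC.isCompact
    have := hwh C (fun c => g c) (hg.comp continuous_subtype_val)
    rwa [Set.image_eq_range]
  rw [← isOpen_compl_iff, isOpen_iff_mem_nhds]
  intro z hz
  have key : ∃ V ∈ nhds z, Disjoint V (g ⁻¹' K) := by
    refine hK.induction_on (p := fun s => ∃ V ∈ nhds z, Disjoint V (g ⁻¹' s)) ?_ ?_ ?_ ?_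
    · exact ⟨Set.univ, Filter.univ_mem, by simp⟩
    · rintro s t hst ⟨V, hV, hd⟩
      exact ⟨V, hV, hd.mono_right (Set.preimage_mono hst)⟩
    · rintro s t ⟨V, hV, hd⟩ ⟨W, hW, hd'⟩
      refine ⟨V ∩ W, Filter.inter_mem hV hW, ?_⟩
      rw [Set.preimage_union]
      exact (hd.mono_left Set.inter_subset_left).union_right
        (hd'.mono_left Set.inter_subset_right)
    · intro k hk
      have hfib : IsCompact (g ⁻¹' {k}) := ((hpt k).preimage hg).isCompact
      have hzk : z ∉ g ⁻¹' {k} := by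
        intro h
        apply hz
        have h' : g z = k := h
        change g z ∈ K
        rwa [h']
      obtain ⟨V, U, hVo, hUo, hzV, hkU, hd⟩ :=
        SeparatedNhds.of_isCompact_isCompact (isCompact_singleton (x := z)) hfib
          (Set.disjoint_singleton_left.mpr hzk)
      refine ⟨(g '' Uᶜ)ᶜ, mem_nhdsWithin_of_mem_nhds ?_, V, ?_, ?_⟩
      · refine (hclosed _ hUo.isClosed_compl).isOpen_compl.mem_nhds ?_
        rintro ⟨u, hu, rfl⟩
        exact hu (hkU rfl)
      · exact hVo.mem_nhds (hzV rfl)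
      · refine hd.mono_right ?_
        intro x hx
        by_contra hxU
        exact hx ⟨x, hxU, rfl⟩
  obtain ⟨V, hV, hd⟩ := key
  exact Filter.mem_of_superset hV fun x hx hx' => Set.disjoint_left.mp hd hx hx'

theorem cont_slice {Y : Type u} [TopologicalSpace Y] (F : PSemiflow Y) (A : Set Y) (t : ℝ≥0)
    (h : ∀ x ∈ A, (t, x) ∈ F.dom) : ContinuousOn (fun x => F.toFun (t, x)) A :=
  F.cont.comp (by fun_prop) h

theorem isCompact_stay {Y : Type u} [TopologicalSpace Y]
    (F : PSemiflow Y) (K : Set Y) (hK : IsCompact K) (hKc : IsClosed K)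
    (hc : ∀ A : Set Y, IsCompact A → IsClosed A)
    (ε : ℝ≥0) (hdom : Set.Icc 0 ε ×ˢ K ⊆ F.dom) (n : ℕ) :
    ∀ b : ℝ≥0, b ≤ n * ε → IsCompact (⋂ t ∈ Set.Icc (0 : ℝ≥0) b, F.fpre t K) := by
  induction n with
  | zero =>
    intro b hb
    have : b = 0 := by simpa using hb
    subst this
    convert hK using 1
    ext x
    simp [fpre, F.mem_zero, F.map_zero]
  | succ n ih =>
    intro b hb
    have hA := ih (min b (n * ε)) (min_le_right _ _)
    set A := ⋂ t ∈ Set.Icc (0 : ℝ≥0) (min b (n * ε)), F.fpre t K with hAdef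
    have hAd : ∀ t ≤ b, ∀ x ∈ A, (t, x) ∈ F.dom := by
      intro t ht x hx
      simp only [hAdef, Set.mem_iInter] at hx
      by_cases hle : t ≤ n * ε
      · exact (hx t ⟨zero_le, le_min ht hle⟩).1
      · push Not at hle
        have h1 := hx (n * ε) ⟨zero_le, le_min (hle.le.trans ht) le_rfl⟩
        have h2 : (t - n * ε, F.toFun (n * ε, x)) ∈ F.dom := by
          refine hdom ⟨⟨zero_le, ?_⟩, h1.2⟩
          refine tsub_le_iff_left.mpr (ht.trans (hb.trans ?_))
          push_cast
          rw [add_mul, one_mul]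
        have := (F.mem_add (t - n * ε) (n * ε) x).mpr ⟨h1.1, h2⟩
        rwa [tsub_add_cancel_of_le hle.le] at this
    have heq : (⋂ t ∈ Set.Icc (0 : ℝ≥0) b, F.fpre t K) =
        A ∩ ⋂ t ∈ Set.Icc (0 : ℝ≥0) b, (A ∩ (fun x => F.toFun (t, x)) ⁻¹' K) := by
      ext x
      simp only [Set.mem_iInter, Set.mem_inter_iff]
      constructor
      · intro h
        have hxA : x ∈ A := by
          simp only [hAdef, Set.mem_iInter]
          exact fun t ht => h t ⟨ht.1, ht.2.trans (min_le_left _ _)⟩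
        exact ⟨hxA, fun t ht => ⟨hxA, (h t ht).2⟩⟩
      · rintro ⟨hxA, h⟩ t ht
        exact ⟨hAd t ht.2 x hxA, (h t ht).2⟩
    rw [heq]
    refine hA.inter_right (isClosed_biInter fun t ht => ?_)
    exact (cont_slice F A t (hAd t ht.2)).preimage_isClosed_of_isClosed (hc A hA) hKc

theorem stmt13 {Y : Type u} [TopologicalSpace Y]
    (hcg : CompactlyGeneratedSpaceP Y) (hwh : WeakHausdorffSpace Y)
    (F : PSemiflow Y) (K : Set Y) (hK : IsCompact K)
    (hdom : ∃ ε : ℝ≥0, 0 < ε ∧ Set.Icc 0 ε ×ˢ K ⊆ F.dom)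
    (a b : ℝ≥0) (hab : a ≤ b) :
    IsCompact ((fun x => F.toFun (a, x)) '' ⋂ t ∈ Set.Icc (0 : ℝ≥0) b, F.fpre t K) ∧
      IsClosed ((fun x => F.toFun (a, x)) '' ⋂ t ∈ Set.Icc (0 : ℝ≥0) b, F.fpre t K) := by
  obtain ⟨ε, hε, hd⟩ := hdom
  have hc := isClosed_of_isCompact_cgwh hcg hwh
  obtain ⟨n, hn⟩ := exists_nat_ge (b / ε)
  have hA := isCompact_stay F K hK (hc K hK) hc ε hd n b ((div_le_iff₀ hε).mp hn)
  have h := hA.image_of_continuousOn (cont_slice F _ a fun x hx => by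
    simp only [Set.mem_iInter] at hx
    exact (hx a ⟨zero_le, hab⟩).1)
  exact ⟨h, hc _ h⟩

end PSemiflow
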